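/- Let X be an Asplund space, φ : X → ℝ ∪ {+∞} a proper lower semicontinuous function, and α > 0. Suppose that for all x, y ∈ X and all x* ∈ ∂̂φ(x), y* ∈ ∂̂φ(y), the implication holds: min{⟨x*, y − x⟩, ⟨y*, x − y⟩} > −α‖y − x‖ implies ⟨x* − y*, x − y⟩ ≥ 0. Then φ is α-robustly quasiconvex. -/

import Mathlib

open Filter Topology

/-- `X` is an Asplund space: every closed separable subspace has separable dual. -/
def IsAsplund (X : Type*) [NormedAddCommGroup X] [NormedSpace ℝ X] : Prop :=
  ∀ Y : Submodule ℝ X, IsClosed (Y : Set X) →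
    TopologicalSpace.SeparableSpace Y →
    TopologicalSpace.SeparableSpace (StrongDual ℝ Y)

/-- Quasiconvexity of an extended-real-valued function. -/
def QuasiconvexFn {X : Type*} [AddCommGroup X] [Module ℝ X] (φ : X → EReal) : Prop :=
  ∀ x y : X, ∀ l : ℝ, 0 < l → l < 1 → φ (l • x + (1 - l) • y) ≤ max (φ x) (φ y)

/-- The Fréchet subdifferential of `φ` at `x`. -/
def FrechetSubdiff {X : Type*} [NormedAddCommGroup X] [NormedSpace ℝ X]
    (φ : X → EReal) (x : X) : Set (X →L[ℝ] ℝ) :=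
  {xs | φ x ≠ ⊤ ∧ ∀ ε : ℝ, 0 < ε →
    ∀ᶠ y in 𝓝 x, φ x + ↑(xs (y - x)) - ↑(ε * ‖y - x‖) ≤ φ y}

/-- `φ` is `α`-robustly quasiconvex. -/
def RobustlyQuasiconvex {X : Type*} [NormedAddCommGroup X] [NormedSpace ℝ X]
    (φ : X → EReal) (α : ℝ) : Prop :=
  ∀ vs : X →L[ℝ] ℝ, ‖vs‖ ≤ α → QuasiconvexFn (fun z => φ z + ↑(vs z))


section smoothnorm
variable {Y : Type*} [NormedAddCommGroup Y] [NormedSpace ℝ Y]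

lemma ultra_weak_limit {ι : Type*} (U : Ultrafilter ι) (p : ι → StrongDual ℝ Y)
    (hp : ∀ i, ‖p i‖ ≤ 1) :
    ∃ p0 : StrongDual ℝ Y, ‖p0‖ ≤ 1 ∧ ∀ x, Tendsto (fun i => p i x) U (𝓝 (p0 x)) := by
  have hc := WeakDual.isCompact_closedBall (0 : StrongDual ℝ Y) 1
  rw [isCompact_iff_ultrafilter_le_nhds] at hc
  obtain ⟨w, hw, hle⟩ := hc (U.map (fun i => StrongDual.toWeakDual (p i))) (by
    rw [le_principal_iff]
    refine Filter.mem_map.2 (Filter.univ_mem' ?_)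
    intro i
    simpa using hp i)
  refine ⟨WeakDual.toStrongDual w, by simpa using hw, fun x => ?_⟩
  have h1 : Tendsto (fun i => StrongDual.toWeakDual (p i)) U (𝓝 w) := hle
  have h2 := (WeakDual.eval_continuous (𝕜 := ℝ) (E := Y) x).tendsto w
  exact h2.comp h1

lemma dual_norm_le_of_tendsto {ι : Type*} (U : Ultrafilter ι) (p : ι → StrongDual ℝ Y)
    (p0 q : StrongDual ℝ Y) (h : ∀ x, Tendsto (fun i => p i x) U (𝓝 (p0 x))) (l : ℝ)
    (hl : Tendsto (fun i => ‖p i - q‖) U (𝓝 l)) : ‖p0 - q‖ ≤ l := by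
  have hl0 : 0 ≤ l := ge_of_tendsto' hl (fun i => norm_nonneg _)
  refine ContinuousLinearMap.opNorm_le_bound _ hl0 (fun x => ?_)
  have h1 : Tendsto (fun i => ‖(p i - q) x‖) U (𝓝 ‖(p0 - q) x‖) := by
    simp only [_root_.sub_apply]
    exact ((h x).sub_const _).norm
  exact le_of_tendsto_of_tendsto' h1 (hl.mul_const _) (fun i => (p i - q).le_opNorm x)

noncomputable def dualPen (ε : ℝ) (q : ℕ → StrongDual ℝ Y) (p : StrongDual ℝ Y) : ℝ :=
  ∑' n, (ε / 4 * (1 / 2) ^ (n + 1)) * ‖p - q n‖ ^ 2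

lemma sum_half_eq (ε : ℝ) : HasSum (fun n : ℕ => ε * (1 / 2 : ℝ) ^ (n + 1)) ε := by
  have h := (hasSum_geometric_two).mul_left (ε / 2)
  have e : ε / 2 * 2 = ε := by ring
  rw [e] at h
  refine h.congr_fun ?_
  intro n
  ring

lemma sq_dist_le_four {p q : StrongDual ℝ Y} (hp : ‖p‖ ≤ 1) (hq : ‖q‖ ≤ 1) :
    ‖p - q‖ ^ 2 ≤ 4 := by
  have h := norm_sub_le p q
  have := norm_nonneg (p - q)
  nlinarith

lemma pen_term_le {ε : ℝ} (hε : 0 < ε) {p q : StrongDual ℝ Y} (hp : ‖p‖ ≤ 1) (hq : ‖q‖ ≤ 1)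
    (n : ℕ) : (ε / 4 * (1 / 2) ^ (n + 1)) * ‖p - q‖ ^ 2 ≤ ε * (1 / 2 : ℝ) ^ (n + 1) := by
  have h := sq_dist_le_four hp hq
  have : 0 ≤ ε / 4 * (1 / 2 : ℝ) ^ (n + 1) := by positivity
  nlinarith

lemma pen_summable {ε : ℝ} (hε : 0 < ε) {q : ℕ → StrongDual ℝ Y} (hq : ∀ n, ‖q n‖ ≤ 1)
    {p : StrongDual ℝ Y} (hp : ‖p‖ ≤ 1) :
    Summable (fun n => (ε / 4 * (1 / 2) ^ (n + 1)) * ‖p - q n‖ ^ 2) :=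
  Summable.of_nonneg_of_le (fun n => by positivity) (fun n => pen_term_le hε hp (hq n) n)
    (sum_half_eq ε).summable

lemma pen_nonneg {ε : ℝ} (hε : 0 < ε) (q : ℕ → StrongDual ℝ Y) (p : StrongDual ℝ Y) :
    0 ≤ dualPen ε q p := tsum_nonneg (fun n => by positivity)

lemma pen_le {ε : ℝ} (hε : 0 < ε) {q : ℕ → StrongDual ℝ Y} (hq : ∀ n, ‖q n‖ ≤ 1)
    {p : StrongDual ℝ Y} (hp : ‖p‖ ≤ 1) : dualPen ε q p ≤ ε := by
  exact ((pen_summable hε hq hp).tsum_le_tsum (fun n => pen_term_le hε hp (hq n) n)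
    (sum_half_eq ε).summable).trans (sum_half_eq ε).tsum_eq.le

lemma pen_wellposed {ε : ℝ} (hε : 0 < ε) {q : ℕ → StrongDual ℝ Y} (hq : ∀ n, ‖q n‖ ≤ 1)
    (hd : ∀ p : StrongDual ℝ Y, ‖p‖ ≤ 1 → ∀ r > 0, ∃ n, ‖p - q n‖ < r)
    {ι : Type*} (U : Ultrafilter ι) (p : ι → StrongDual ℝ Y) (hp : ∀ i, ‖p i‖ ≤ 1)
    (y : ι → Y) (x : Y) (hy : Tendsto y U (𝓝 x)) (s : ℝ)
    (hs : Tendsto (fun i => p i (y i) - dualPen ε q (p i)) U (𝓝 s))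
    (hmax : ∀ p : StrongDual ℝ Y, ‖p‖ ≤ 1 → p x - dualPen ε q p ≤ s) :
    ∃ p0 : StrongDual ℝ Y, ‖p0‖ ≤ 1 ∧ p0 x - dualPen ε q p0 = s ∧ Tendsto p U (𝓝 p0) := by
  obtain ⟨p0, hp0, hw⟩ := ultra_weak_limit U p hp
  have hl : ∀ n, ∃ l, Tendsto (fun i => ‖p i - q n‖) U (𝓝 l) := by
    intro n
    have hc := (isCompact_Icc (a := (0:ℝ)) (b := 2))
    rw [isCompact_iff_ultrafilter_le_nhds] at hc
    obtain ⟨l, -, h⟩ := hc (U.map (fun i => ‖p i - q n‖)) (by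
      rw [le_principal_iff]
      refine Filter.mem_map.2 (Filter.univ_mem' fun i => ?_)
      refine ⟨norm_nonneg _, (norm_sub_le _ _).trans ?_⟩
      linarith [hp i, hq n])
    exact ⟨l, h⟩
  choose l hl using hl
  have hle : ∀ n, ‖p0 - q n‖ ≤ l n := fun n => dual_norm_le_of_tendsto U p p0 (q n) hw _ (hl n)
  have hpen : Tendsto (fun i => dualPen ε q (p i)) U
      (𝓝 (∑' n, (ε / 4 * (1 / 2) ^ (n + 1)) * (l n) ^ 2)) := by
    refine tendsto_tsum_of_dominated_convergence (sum_half_eq ε).summable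
      (fun n => ((hl n).pow 2).const_mul _) (Eventually.of_forall fun i n => ?_)
    rw [Real.norm_of_nonneg (by positivity)]
    exact pen_term_le hε (hp i) (hq n) n
  have hl4 : ∀ n, (l n) ^ 2 ≤ 4 := fun n =>
    le_of_tendsto' ((hl n).pow 2) (fun i => sq_dist_le_four (hp i) (hq n))
  have hsl : Summable (fun n => (ε / 4 * (1 / 2) ^ (n + 1)) * (l n) ^ 2) := by
    refine Summable.of_nonneg_of_le (fun n => by positivity) (fun n => ?_)
      (sum_half_eq ε).summable
    have : 0 ≤ ε / 4 * (1 / 2 : ℝ) ^ (n + 1) := by positivity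
    nlinarith [hl4 n]
  have hev : Tendsto (fun i => p i (y i)) U (𝓝 (p0 x)) := by
    have h1 : Tendsto (fun i => p i (y i - x)) U (𝓝 0) := by
      have h2 : Tendsto (fun i => ‖y i - x‖) U (𝓝 0) := by
        have := (hy.sub_const x).norm
        simpa using this
      refine squeeze_zero_norm (fun i => ?_) h2
      refine ((p i).le_opNorm _).trans ?_
      nlinarith [hp i, norm_nonneg (y i - x)]
    have h3 := h1.add (hw x)
    simpa using h3
  have hseq := tendsto_nhds_unique hs (hev.sub hpen)
  have hterm : ∀ n, (ε / 4 * (1 / 2) ^ (n + 1)) * ‖p0 - q n‖ ^ 2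
      ≤ (ε / 4 * (1 / 2) ^ (n + 1)) * (l n) ^ 2 := by
    intro n
    have := hle n
    gcongr
  have hGle : dualPen ε q p0 ≤ ∑' n, (ε / 4 * (1 / 2) ^ (n + 1)) * (l n) ^ 2 :=
    (pen_summable hε hq hp0).tsum_le_tsum hterm hsl
  have hm := hmax p0 hp0
  have hGeq : dualPen ε q p0 = ∑' n, (ε / 4 * (1 / 2) ^ (n + 1)) * (l n) ^ 2 := by linarith
  have hleq : ∀ n, l n = ‖p0 - q n‖ := by
    intro n
    by_contra hne
    have hlt : ‖p0 - q n‖ < l n := lt_of_le_of_ne (hle n) (Ne.symm hne)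
    have : dualPen ε q p0 < ∑' n, (ε / 4 * (1 / 2) ^ (n + 1)) * (l n) ^ 2 := by
      refine Summable.tsum_lt_tsum (i := n) hterm ?_ (pen_summable hε hq hp0) hsl
      gcongr
    linarith
  refine ⟨p0, hp0, by linarith, ?_⟩
  rw [tendsto_iff_norm_sub_tendsto_zero]
  rw [Metric.tendsto_nhds]
  intro r hr
  obtain ⟨n, hn⟩ := hd p0 hp0 (r / 2) (by linarith)
  have h1 := hl n
  rw [hleq n] at h1
  filter_upwards [h1.eventually (gt_mem_nhds hn)] with i hi
  rw [Real.dist_eq, sub_zero, abs_of_nonneg (norm_nonneg _)]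
  have : p i - p0 = (p i - q n) - (p0 - q n) := by abel
  rw [this]
  exact (norm_sub_le _ _).trans_lt (by linarith)

lemma pen_unique {ε : ℝ} (hε : 0 < ε) {q : ℕ → StrongDual ℝ Y} (hq : ∀ n, ‖q n‖ ≤ 1)
    (hd : ∀ p : StrongDual ℝ Y, ‖p‖ ≤ 1 → ∀ r > 0, ∃ n, ‖p - q n‖ < r)
    (x : Y) (s : ℝ) (hmax : ∀ p : StrongDual ℝ Y, ‖p‖ ≤ 1 → p x - dualPen ε q p ≤ s)
    (p p' : StrongDual ℝ Y) (hp : ‖p‖ ≤ 1) (hp' : ‖p'‖ ≤ 1)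
    (h : p x - dualPen ε q p = s) (h' : p' x - dualPen ε q p' = s) : p = p' := by
  set m : StrongDual ℝ Y := (1 / 2 : ℝ) • (p + p') with hm
  have hnm : ‖m‖ ≤ 1 := by
    rw [hm, norm_smul]
    have := norm_add_le p p'
    norm_num
    linarith
  have hmid : ∀ n, ‖m - q n‖ ≤ (‖p - q n‖ + ‖p' - q n‖) / 2 := by
    intro n
    have : m - q n = (1 / 2 : ℝ) • ((p - q n) + (p' - q n)) := by
      rw [hm]; module
    rw [this, norm_smul]
    have := norm_add_le (p - q n) (p' - q n)
    norm_num
    linarith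
  have hsq : ∀ n, ‖m - q n‖ ^ 2 ≤ (‖p - q n‖ ^ 2 + ‖p' - q n‖ ^ 2) / 2
      - (‖p - q n‖ - ‖p' - q n‖) ^ 2 / 4 := by
    intro n
    have h1 := pow_le_pow_left₀ (norm_nonneg _) (hmid n) 2
    nlinarith
  have hS1 := (pen_summable hε hq hp)
  have hS2 := (pen_summable hε hq hp')
  have hS := (hS1.add hS2).mul_left (1 / 2)
  have hSm := pen_summable hε hq hnm
  have hval : ∑' n, (1 / 2 : ℝ) * ((ε / 4 * (1 / 2) ^ (n + 1)) * ‖p - q n‖ ^ 2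
      + (ε / 4 * (1 / 2) ^ (n + 1)) * ‖p' - q n‖ ^ 2) = (dualPen ε q p + dualPen ε q p') / 2 := by
    rw [tsum_mul_left, hS1.tsum_add hS2]
    unfold dualPen
    ring
  have hterm : ∀ n, (ε / 4 * (1 / 2) ^ (n + 1)) * ‖m - q n‖ ^ 2 ≤
      (1 / 2 : ℝ) * ((ε / 4 * (1 / 2) ^ (n + 1)) * ‖p - q n‖ ^ 2
      + (ε / 4 * (1 / 2) ^ (n + 1)) * ‖p' - q n‖ ^ 2) := by
    intro n
    have hw : 0 ≤ ε / 4 * (1 / 2 : ℝ) ^ (n + 1) := by positivity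
    have := mul_le_mul_of_nonneg_left (hsq n) hw
    nlinarith [mul_nonneg hw (sq_nonneg (‖p - q n‖ - ‖p' - q n‖))]
  have hmm := hmax m hnm
  have hmx : m x = (p x + p' x) / 2 := by
    rw [hm]; simp; ring
  have heq : ∀ n, ‖p - q n‖ = ‖p' - q n‖ := by
    intro n
    by_contra hne
    have hpos : 0 < (‖p - q n‖ - ‖p' - q n‖) ^ 2 := by
      have := sub_ne_zero.2 hne
      positivity
    have : dualPen ε q m < ∑' n, (1 / 2 : ℝ) * ((ε / 4 * (1 / 2) ^ (n + 1)) * ‖p - q n‖ ^ 2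
      + (ε / 4 * (1 / 2) ^ (n + 1)) * ‖p' - q n‖ ^ 2) := by
      refine Summable.tsum_lt_tsum (i := n) hterm ?_ hSm hS
      have hw : 0 < ε / 4 * (1 / 2 : ℝ) ^ (n + 1) := by positivity
      have := mul_le_mul_of_nonneg_left (hsq n) hw.le
      nlinarith [mul_pos hw hpos]
    rw [hval] at this
    rw [hmx] at hmm
    linarith
  by_contra hne
  have hpos : 0 < ‖p - p'‖ := norm_pos_iff.2 (sub_ne_zero.2 hne)
  obtain ⟨n, hn⟩ := hd p hp (‖p - p'‖ / 2) (by linarith)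
  have h2 := heq n
  have : p - p' = (p - q n) - (p' - q n) := by abel
  have h3 := norm_sub_le (p - q n) (p' - q n)
  rw [← this] at h3
  linarith

lemma exists_smooth_conv {ε : ℝ} (hε : 0 < ε) {q : ℕ → StrongDual ℝ Y} (hq : ∀ n, ‖q n‖ ≤ 1)
    (hd : ∀ p : StrongDual ℝ Y, ‖p‖ ≤ 1 → ∀ r > 0, ∃ n, ‖p - q n‖ < r) :
    ∃ (g : Y → ℝ) (g' : Y → StrongDual ℝ Y), (∀ x, HasFDerivAt g (g' x) x) ∧
      (∀ x y, g x + g' x (y - x) ≤ g y) ∧ (∀ x, ‖g' x‖ ≤ 1) ∧ g 0 ≤ 0 ∧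
      ∀ x, ‖x‖ - ε ≤ g x := by
  have hex : ∀ x : Y, ∃ P : StrongDual ℝ Y, ‖P‖ ≤ 1 ∧
      ∀ p : StrongDual ℝ Y, ‖p‖ ≤ 1 → p x - dualPen ε q p ≤ P x - dualPen ε q P := by
    intro x
    set S : Set ℝ := (fun p : StrongDual ℝ Y => p x - dualPen ε q p) '' {p | ‖p‖ ≤ 1} with hS
    have hne : S.Nonempty := ⟨_, 0, by simp, rfl⟩
    have hb : BddAbove S := by
      refine ⟨‖x‖, ?_⟩
      rintro _ ⟨p, hp, rfl⟩
      have hp : ‖p‖ ≤ 1 := hp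
      have h1 := (le_abs_self (p x)).trans (p.le_opNorm x)
      have := pen_nonneg hε q p
      have h2 := mul_le_mul_of_nonneg_right hp (norm_nonneg x)
      simp only
      linarith
    obtain ⟨u, -, hu, hmem⟩ := exists_seq_tendsto_sSup hne hb
    choose p hp hpu using hmem
    have hmax : ∀ p : StrongDual ℝ Y, ‖p‖ ≤ 1 → p x - dualPen ε q p ≤ sSup S :=
      fun p hp => le_csSup hb ⟨p, hp, rfl⟩
    obtain ⟨p0, h0, h1, -⟩ := pen_wellposed hε hq hd (hyperfilter ℕ) p hp (fun _ => x) x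
      tendsto_const_nhds (sSup S) (by
        have : (fun i => (p i) x - dualPen ε q (p i)) = u := funext hpu
        rw [this]
        exact hu.mono_left (by
          have := hyperfilter_le_cofinite (α := ℕ)
          rwa [Nat.cofinite_eq_atTop] at this)) hmax
    exact ⟨p0, h0, fun p hp => (hmax p hp).trans h1.ge⟩
  choose P hP1 hPm using hex
  have hsub : ∀ x y, (P x x - dualPen ε q (P x)) + P x (y - x) ≤ P y y - dualPen ε q (P y) := by
    intro x y
    have := hPm y (P x) (hP1 x)
    rw [map_sub]
    linarith
  have hbd : ∀ (p : StrongDual ℝ Y) (x : Y), ‖p‖ ≤ 1 → |p x| ≤ ‖x‖ := by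
    intro p x hp
    have h1 := p.le_opNorm x
    rw [Real.norm_eq_abs] at h1
    nlinarith [norm_nonneg x]
  have hlip : ∀ x y, |(P x x - dualPen ε q (P x)) - (P y y - dualPen ε q (P y))| ≤ ‖x - y‖ := by
    intro x y
    have h1 := hsub x y
    have h2 := hsub y x
    have h3 := abs_le.1 (hbd (P x) (y - x) (hP1 x))
    have h4 := abs_le.1 (hbd (P y) (x - y) (hP1 y))
    rw [norm_sub_rev] at h3
    rw [abs_le]
    constructor <;> linarith
  have hcont : ∀ x, Tendsto P (𝓝 x) (𝓝 (P x)) := by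
    intro x
    rw [tendsto_iff_ultrafilter]
    intro U hU
    have hU' : Tendsto (fun y : Y => y) U (𝓝 x) := hU
    obtain ⟨p0, h0, h1, h2⟩ := pen_wellposed hε hq hd U P hP1 (fun y => y) x hU'
      (P x x - dualPen ε q (P x)) (by
        rw [tendsto_iff_norm_sub_tendsto_zero]
        have h2 : Tendsto (fun y : Y => ‖y - x‖) U (𝓝 0) := by
          have := (hU'.sub_const x).norm
          simpa using this
        exact squeeze_zero (fun y => norm_nonneg _) (fun y => hlip y x) h2) (hPm x)
    have := pen_unique hε hq hd x _ (hPm x) p0 (P x) h0 (hP1 x) h1 rfl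
    rwa [this] at h2
  refine ⟨fun x => P x x - dualPen ε q (P x), P, ?_, hsub, hP1, ?_, ?_⟩
  · intro x
    rw [hasFDerivAt_iff_isLittleO, Asymptotics.isLittleO_iff]
    intro c hc
    have := hcont x
    rw [Metric.tendsto_nhds] at this
    filter_upwards [this c hc] with y hy
    have h1 := hsub x y
    have h2 := hsub y x
    have h3 : (P y - P x) (y - x) ≤ c * ‖y - x‖ := by
      refine (le_abs_self _).trans (((P y - P x).le_opNorm (y - x)).trans ?_)
      rw [dist_eq_norm] at hy
      gcongr
    rw [Real.norm_eq_abs, abs_of_nonneg (by linarith)]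
    rw [_root_.sub_apply] at h3
    have h4 : P y (x - y) = - P y (y - x) := by rw [← map_neg, neg_sub]
    linarith
  · have := pen_nonneg hε q (P 0)
    simp only [map_zero]
    linarith
  · intro x
    obtain ⟨p, hp, hpx⟩ := exists_dual_vector'' ℝ x
    have h1 := hPm x p hp
    have h2 := pen_le hε hq hp
    have h3 : p x = ‖x‖ := by simpa using hpx
    simp only
    linarith

lemma exists_smooth_norm [TopologicalSpace.SeparableSpace (StrongDual ℝ Y)] {ε : ℝ} (hε : 0 < ε) :
    ∃ (g : Y → ℝ) (g' : Y → StrongDual ℝ Y), (∀ x, HasFDerivAt g (g' x) x) ∧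
      (∀ x y, g x + g' x (y - x) ≤ g y) ∧ (∀ x, ‖g' x‖ ≤ 1) ∧ g 0 = 0 ∧ (∀ x, 0 ≤ g x) ∧
      ∀ x, ‖x‖ - ε ≤ g x := by
  have : SecondCountableTopology (StrongDual ℝ Y) :=
    UniformSpace.secondCountable_of_separable _
  have : Nonempty (Metric.closedBall (0 : StrongDual ℝ Y) 1) := ⟨⟨0, by simp⟩⟩
  let q : ℕ → StrongDual ℝ Y :=
    fun n => (TopologicalSpace.denseSeq (Metric.closedBall (0 : StrongDual ℝ Y) 1) n : _)
  have hq : ∀ n, ‖q n‖ ≤ 1 := fun n => by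
    exact mem_closedBall_zero_iff.1
      (TopologicalSpace.denseSeq (Metric.closedBall (0 : StrongDual ℝ Y) 1) n).2
  have hd : ∀ p : StrongDual ℝ Y, ‖p‖ ≤ 1 → ∀ r > 0, ∃ n, ‖p - q n‖ < r := by
    intro p hp r hr
    have h := TopologicalSpace.denseRange_denseSeq (Metric.closedBall (0 : StrongDual ℝ Y) 1)
    obtain ⟨n, hn⟩ := h.exists_dist_lt ⟨p, by simpa using hp⟩ hr
    refine ⟨n, ?_⟩
    rw [← dist_eq_norm]
    exact hn
  obtain ⟨g, g', h1, h2, h3, h4, h5⟩ := exists_smooth_conv hε hq hd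
  refine ⟨fun x => (1 / 2 : ℝ) * (g x + g (-x)) - g 0,
    fun x => (1 / 2 : ℝ) • (g' x - g' (-x)), ?_, ?_, ?_, ?_, ?_, ?_⟩
  · intro x
    have ha : HasFDerivAt (fun x => g (-x)) (-(g' (-x))) x := by
      have h := (h1 (-x)).comp x (hasFDerivAt_id x).neg
      refine HasFDerivAt.congr_fderiv h ?_
      ext v
      simp
    have := (((h1 x).add ha).const_mul (1 / 2 : ℝ)).sub_const (g 0)
    refine HasFDerivAt.congr_fderiv this ?_
    simp only [sub_eq_add_neg]
  · intro x y
    have ha := h2 x y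
    have hb := h2 (-x) (-y)
    have : -y - -x = -(y - x) := by abel
    rw [this, map_neg] at hb
    simp only [smul_apply, _root_.sub_apply, smul_eq_mul]
    linarith
  · intro x
    rw [norm_smul]
    have := norm_sub_le (g' x) (g' (-x))
    have ha := h3 x
    have hb := h3 (-x)
    norm_num
    linarith
  · simp; ring
  · intro x
    have ha := h2 0 x
    have hb := h2 0 (-x)
    simp only [sub_zero, map_neg] at ha hb
    simp only
    linarith
  · intro x
    have ha := h5 x
    have hb := h5 (-x)
    rw [norm_neg] at hb
    simp only
    linarith
end smoothnorm

section variational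
variable {Y : Type*} [NormedAddCommGroup Y] [NormedSpace ℝ Y]

lemma exists_approx_min {Y : Type*} (C : Set Y) (F : Y → ℝ) (m : ℝ) (hm : ∀ x ∈ C, m ≤ F x) (x : Y)
    (hx : x ∈ C) (σ : ℝ) (hσ : 0 < σ) :
    ∃ x' ∈ C, F x' ≤ F x ∧ ∀ y ∈ C, F x' ≤ F y + σ := by
  have hne : (F '' C).Nonempty := ⟨_, x, hx, rfl⟩
  have hb : BddBelow (F '' C) := ⟨m, by rintro _ ⟨y, hy, rfl⟩; exact hm y hy⟩
  obtain ⟨_, ⟨x1, hx1, rfl⟩, h1⟩ := exists_lt_of_csInf_lt hne (lt_add_of_pos_right (sInf (F '' C)) hσ)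
  have h2 : ∀ y ∈ C, F x1 ≤ F y + σ := fun y hy => by
    have := csInf_le hb ⟨y, hy, rfl⟩
    linarith
  rcases le_total (F x1) (F x) with h | h
  · exact ⟨x1, hx1, h, h2⟩
  · exact ⟨x, hx, le_rfl, fun y hy => h.trans (h2 y hy)⟩

lemma smooth_variational [CompleteSpace Y] [TopologicalSpace.SeparableSpace (StrongDual ℝ Y)]
    (C : Set Y) (F : Y → ℝ) (hcl : ∀ c : ℝ, IsClosed {x | x ∈ C ∧ F x ≤ c})
    (m : ℝ) (hm : ∀ x ∈ C, m ≤ F x) (z0 : Y) (hz0 : z0 ∈ C) (η : ℝ) (hη : 0 < η) :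
    ∃ xb ∈ C, F xb ≤ F z0 ∧ ∃ (Q : Y → ℝ) (q : StrongDual ℝ Y), HasFDerivAt Q q xb ∧ ‖q‖ ≤ η ∧
      ∀ x ∈ C, F xb + Q xb ≤ F x + Q x := by
  have hpos : ∀ n : ℕ, (0 : ℝ) < (1 / 2) ^ n := fun n => by positivity
  choose g g' hg1 hg2 hg3 hg4 hg5 hg6 using
    fun n : ℕ => exists_smooth_norm (Y := Y) (hpos n)
  set μ : ℕ → ℝ := fun n => η * (1 / 2) ^ (n + 1) with hμ
  have hμ0 : ∀ n, 0 < μ n := fun n => by simp only [hμ]; positivity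
  -- state of the iteration
  let St := {s : (Y → ℝ) × Y // (∀ y, 0 ≤ s.1 y) ∧ s.2 ∈ C}
  have hstep : ∀ (n : ℕ) (s : St), ∃ s' : St,
      s'.1.1 = (fun y => s.1.1 y + μ n * g n (y - s.1.2)) ∧
      F s'.1.2 + s'.1.1 s'.1.2 ≤ F s.1.2 + s'.1.1 s.1.2 ∧
      ∀ y ∈ C, F s'.1.2 + s'.1.1 s'.1.2 ≤ F y + s'.1.1 y + μ (n + 1) * (1 / 2) ^ (n + 1) := by
    rintro n ⟨⟨h, x⟩, hh, hx⟩
    have hh' : ∀ y, 0 ≤ h y + μ n * g n (y - x) := fun y =>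
      add_nonneg (hh y) (mul_nonneg (hμ0 n).le (hg5 n _))
    obtain ⟨x', hx', h1, h2⟩ := exists_approx_min C (fun y => F y + (h y + μ n * g n (y - x))) m
      (fun y hy => by have := hm y hy; have := hh' y; linarith) x hx
      (μ (n + 1) * (1 / 2) ^ (n + 1)) (mul_pos (hμ0 _) (hpos _))
    exact ⟨⟨⟨fun y => h y + μ n * g n (y - x), x'⟩, hh', hx'⟩, rfl, h1, h2⟩
  choose step hst1 hst2 hst3 using hstep
  obtain ⟨x0, hx0, hx01, hx02⟩ := exists_approx_min C F m hm z0 hz0 (μ 0 * (1 / 2) ^ 0)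
    (mul_pos (hμ0 _) (hpos _))
  let s : ℕ → St := fun n => Nat.rec ⟨⟨fun _ => 0, x0⟩, fun _ => le_rfl, hx0⟩ step n
  have hs0 : s 0 = ⟨⟨fun _ => 0, x0⟩, fun _ => le_rfl, hx0⟩ := rfl
  have hsS : ∀ n, s (n + 1) = step n (s n) := fun n => rfl
  set x : ℕ → Y := fun n => (s n).1.2 with hxdef
  set h : ℕ → Y → ℝ := fun n => (s n).1.1 with hhdef
  have hxC : ∀ n, x n ∈ C := fun n => (s n).2.2
  have hh0 : ∀ n y, 0 ≤ h n y := fun n => (s n).2.1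
  have hhS : ∀ n y, h (n + 1) y = h n y + μ n * g n (y - x n) := by
    intro n y
    simp only [hhdef, hxdef, hsS, hst1]
  have hdec : ∀ n, F (x (n + 1)) + h (n + 1) (x (n + 1)) ≤ F (x n) + h (n + 1) (x n) :=
    fun n => hst2 n (s n)
  have hself : ∀ n, h (n + 1) (x n) = h n (x n) := by
    intro n
    rw [hhS, sub_self, hg4, mul_zero, add_zero]
  have happ : ∀ n, ∀ y ∈ C, F (x n) + h n (x n) ≤ F y + h n y + μ n * (1 / 2) ^ n := by
    intro n
    cases n with
    | zero =>
      intro y hy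
      have := hx02 y hy
      simp only [hxdef, hhdef, hs0]
      linarith
    | succ n => exact hst3 n (s n)
  -- the iterates are Cauchy
  have hgs : ∀ n, g n (x (n + 1) - x n) ≤ (1 / 2) ^ n := by
    intro n
    have h1 := happ n (x (n + 1)) (hxC (n + 1))
    have h2 := hdec n
    rw [hself, hhS] at h2
    have h3 : μ n * g n (x (n + 1) - x n) ≤ μ n * (1 / 2) ^ n := by linarith
    exact le_of_mul_le_mul_left h3 (hμ0 n)
  have hdist : ∀ n, dist (x n) (x (n + 1)) ≤ 4 / 2 / 2 ^ n := by
    intro n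
    rw [dist_comm, dist_eq_norm]
    have h1 := hgs n
    have h2 := hg6 n (x (n + 1) - x n)
    have h3 : (4 / 2 / 2 ^ n : ℝ) = (1 / 2) ^ n + (1 / 2) ^ n := by
      rw [one_div, inv_pow]; ring
    linarith
  have hcau := cauchySeq_of_le_geometric_two hdist
  obtain ⟨xb, hxb⟩ := cauchySeq_tendsto_of_complete hcau
  have hxbd : ∀ n, dist (x n) xb ≤ 4 := by
    intro n
    have := dist_le_of_le_geometric_two_of_tendsto hdist hxb n
    refine this.trans ?_
    rw [div_le_iff₀ (by positivity)]
    have : (1 : ℝ) ≤ 2 ^ n := one_le_pow₀ (by norm_num)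
    linarith
  -- bounds on g
  have hgle : ∀ n u, g n u ≤ ‖u‖ := by
    intro n u
    have h1 := hg2 n u 0
    rw [hg4, zero_sub, map_neg] at h1
    have h2 := (le_abs_self _).trans ((g' n u).le_opNorm u)
    nlinarith [hg3 n u, norm_nonneg u]
  have hgc : ∀ n, Continuous (g n) := fun n =>
    continuous_iff_continuousAt.2 fun u => (hg1 n u).continuousAt
  have hhc : ∀ n, Continuous (h n) := by
    intro n
    induction n with
    | zero => exact continuous_const
    | succ n ih =>
      have : h (n + 1) = fun y => h n y + μ n * g n (y - x n) := funext (hhS n)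
      rw [this]
      exact ih.add (continuous_const.mul ((hgc n).comp (continuous_id.sub continuous_const)))
  have hsumη := sum_half_eq η
  have hsum : ∀ y, Summable (fun n => μ n * g n (y - x n)) := by
    intro y
    refine Summable.of_nonneg_of_le (fun n => mul_nonneg (hμ0 n).le (hg5 n _)) (fun n => ?_)
      (hsumη.summable.mul_right (‖y - xb‖ + 4))
    have h1 := hgle n (y - x n)
    have h2 : ‖y - x n‖ ≤ ‖y - xb‖ + 4 := by
      have := hxbd n
      rw [dist_comm, dist_eq_norm] at this
      have h3 := norm_add_le (y - xb) (xb - x n)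
      rw [sub_add_sub_cancel] at h3
      linarith
    exact mul_le_mul_of_nonneg_left (h1.trans h2) (hμ0 n).le
  set Q : Y → ℝ := fun y => ∑' n, μ n * g n (y - x n) with hQ
  have hhsum : ∀ n y, h n y = ∑ i ∈ Finset.range n, μ i * g i (y - x i) := by
    intro n y
    induction n with
    | zero => rfl
    | succ n ih => rw [hhS, ih, Finset.sum_range_succ]
  have hlim : ∀ y, Tendsto (fun n => h n y) atTop (𝓝 (Q y)) := by
    intro y
    simp only [hhsum]
    exact (hsum y).hasSum.tendsto_sum_nat
  have hmono : ∀ y, Monotone (fun n => h n y) := by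
    intro y
    refine monotone_nat_of_le_succ fun n => ?_
    rw [hhS]
    have := mul_nonneg (hμ0 n).le (hg5 n (y - x n))
    linarith
  have hhQ : ∀ n y, h n y ≤ Q y := fun n y => (hmono y).ge_of_tendsto (hlim y) n
  -- the values decrease
  set v : ℕ → ℝ := fun n => F (x n) + h n (x n) with hv
  have hva : Antitone v := antitone_nat_of_succ_le fun n => by
    have := hdec n
    rw [hself] at this
    exact this
  have hvb : BddBelow (Set.range v) := ⟨m, by
    rintro _ ⟨n, rfl⟩
    have := hm _ (hxC n)
    have := hh0 n (x n)
    simp only [hv]; linarith⟩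
  have hvl := tendsto_atTop_ciInf hva hvb
  set L := ⨅ n, v n with hL
  have hlow : ∀ n c, L - h n xb < c → xb ∈ C ∧ F xb ≤ c := by
    intro n c hc
    have h1 : Tendsto (fun k => v k - h n (x k)) atTop (𝓝 (L - h n xb)) :=
      hvl.sub (((hhc n).tendsto xb).comp hxb)
    have h2 : ∀ᶠ k in atTop, x k ∈ {y | y ∈ C ∧ F y ≤ c} := by
      filter_upwards [h1.eventually (gt_mem_nhds hc), eventually_ge_atTop n] with k hk hkn
      refine ⟨hxC k, ?_⟩
      have := hmono (x k) hkn
      simp only [hv] at hk this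
      linarith
    exact (hcl c).mem_of_tendsto hxb h2
  have hxbC : xb ∈ C := (hlow 0 _ (lt_add_one _)).1
  have hFn : ∀ n, F xb + h n xb ≤ L := by
    intro n
    have : F xb ≤ L - h n xb := le_of_forall_gt_imp_ge_of_dense fun c hc => (hlow n c hc).2
    linarith
  have hFQ : F xb + Q xb ≤ L := le_of_tendsto' ((hlim xb).const_add (F xb)) hFn
  have hup : ∀ y ∈ C, L ≤ F y + Q y := by
    intro y hy
    have h0 : Tendsto (fun n => μ n * (1 / 2 : ℝ) ^ n) atTop (𝓝 0) := by
      have ha := hsumη.summable.tendsto_atTop_zero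
      have hb := tendsto_pow_atTop_nhds_zero_of_lt_one (r := (1 / 2 : ℝ)) (by norm_num) (by norm_num)
      have := ha.mul hb
      rw [mul_zero] at this
      exact this
    have h1 : Tendsto (fun n => F y + Q y + μ n * (1 / 2 : ℝ) ^ n) atTop (𝓝 (F y + Q y + 0)) :=
      h0.const_add _
    rw [add_zero] at h1
    refine le_of_tendsto_of_tendsto' hvl h1 (fun n => ?_)
    have := happ n y hy
    have := hhQ n y
    simp only [hv]; linarith
  have hQ0 : 0 ≤ Q xb := tsum_nonneg fun n => mul_nonneg (hμ0 n).le (hg5 n _)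
  refine ⟨xb, hxbC, ?_, Q, ∑' n, μ n • g' n (xb - x n), ?_, ?_, fun y hy => hFQ.trans (hup y hy)⟩
  · have h1 : L ≤ v 0 := ciInf_le hvb 0
    have h2 : v 0 = F x0 := by simp only [hv, hxdef, hhdef, hs0, add_zero]
    linarith
  · refine hasFDerivAt_tsum (f' := fun n y => μ n • g' n (y - x n)) hsumη.summable ?_ ?_ (hsum xb) xb
    · intro n y
      have h1 : HasFDerivAt (fun y => g n (y - x n)) (g' n (y - x n)) y := by
        have h := (hg1 n (y - x n)).comp y ((hasFDerivAt_id y).sub_const (x n))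
        exact h
      exact h1.const_mul (μ n)
    · intro n y
      rw [norm_smul, Real.norm_of_nonneg (hμ0 n).le]
      exact mul_le_of_le_one_right (hμ0 n).le (hg3 n _)
  · refine tsum_of_norm_bounded hsumη fun n => ?_
    rw [norm_smul, Real.norm_of_nonneg (hμ0 n).le]
    exact mul_le_of_le_one_right (hμ0 n).le (hg3 n _)
end variational

section meanvalue

lemma deriv_nonneg_of_right_min (k : ℝ → ℝ) (k' t0 : ℝ) (hk : HasDerivAt k k' t0) (ht : t0 < 1)
    (hmin : ∀ t, t0 < t → t ≤ 1 → k t0 ≤ k t) : 0 ≤ k' := by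
  have h1 := hasDerivAt_iff_tendsto_slope.1 hk
  have h2 : Tendsto (slope k t0) (𝓝[>] t0) (𝓝 k') :=
    h1.mono_left (nhdsWithin_mono _ fun t ht => ne_of_gt ht)
  refine ge_of_tendsto h2 ?_
  filter_upwards [Ioc_mem_nhdsGT ht] with t htt
  rw [slope_def_field]
  exact div_nonneg (sub_nonneg.2 (hmin t htt.1 htt.2)) (sub_nonneg.2 htt.1.le)

variable {Y : Type*} [NormedAddCommGroup Y] [NormedSpace ℝ Y]

lemma subdiff_of_local_min (ψ : Y → EReal) (hnb : ∀ x, ψ x ≠ ⊥) (xb : Y) (hx : ψ xb ≠ ⊤)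
    (R : Y → ℝ) (R' : StrongDual ℝ Y) (hR : HasFDerivAt R R' xb)
    (hmin : ∀ᶠ y in 𝓝 xb, ψ y ≠ ⊤ → (ψ xb).toReal + R xb ≤ (ψ y).toReal + R y) :
    -R' ∈ FrechetSubdiff ψ xb := by
  refine ⟨hx, fun ε hε => ?_⟩
  rw [hasFDerivAt_iff_isLittleO, Asymptotics.isLittleO_iff] at hR
  filter_upwards [hmin, hR hε] with y hy1 hy2
  by_cases hy : ψ y = ⊤
  · rw [hy]; exact le_top
  have h1 := hy1 hy
  rw [Real.norm_eq_abs] at hy2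
  have h2 := (abs_le.1 hy2).2
  rw [← EReal.coe_toReal hy (hnb y), ← EReal.coe_toReal hx (hnb xb)]
  rw [← EReal.coe_add, ← EReal.coe_sub, EReal.coe_le_coe_iff]
  have : (-R') (y - xb) = - R' (y - xb) := rfl
  rw [this]
  linarith

lemma mvt_sep [CompleteSpace Y] [TopologicalSpace.SeparableSpace (StrongDual ℝ Y)]
    (ψ : Y → EReal) (hlsc : LowerSemicontinuous ψ) (hnb : ∀ x, ψ x ≠ ⊥) (a e : Y) (T : ℝ)
    (hT : 1 < T) (hab : ψ a < ψ (a + e)) (ε : ℝ) (hε : 0 < ε) :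
    ∃ t : ℝ, 0 ≤ t ∧ t < 1 ∧ ∃ c : Y, ‖c - (a + t • e)‖ ≤ ε ∧ ∃ cs ∈ FrechetSubdiff ψ c,
      0 < cs (a + T • e - c) := by
  have hatop : ψ a ≠ ⊤ := ne_top_of_lt hab
  obtain ⟨r, hr1, hr2⟩ := EReal.lt_iff_exists_real_btwn.1 hab
  set A := (ψ a).toReal with hA
  have hAr : A < r := by
    rw [← EReal.coe_toReal hatop (hnb a)] at hr1
    exact EReal.coe_lt_coe_iff.1 hr1
  set δ := (r - A) / 2 with hδ
  have hδ0 : 0 < δ := by rw [hδ]; linarith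
  have hpc : Continuous (fun t : ℝ => a + t • e) := by fun_prop
  set S : Set Y := (fun t : ℝ => a + t • e) '' Set.Icc 0 1 with hS
  have hSc : IsCompact S := isCompact_Icc.image hpc
  have hSne : S.Nonempty := ⟨_, 0, by simp, rfl⟩
  obtain ⟨s0, hs0, hs0m⟩ := LowerSemicontinuousOn.exists_isMinOn hSne hSc
    (hlsc.lowerSemicontinuousOn S)
  obtain ⟨m, -, hm⟩ := EReal.lt_iff_exists_real_btwn.1 (bot_lt_iff_ne_bot.2 (hnb s0))
  obtain ⟨ρ1, hρ1, hsub1⟩ := hSc.exists_cthickening_subset_open (hlsc.isOpen_preimage (m : EReal))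
    (fun s hs => lt_of_lt_of_le hm (hs0m hs))
  obtain ⟨ρ2, hρ2, hsub2⟩ := Metric.isOpen_iff.1 (hlsc.isOpen_preimage (r : EReal)) (a + e) hr2
  obtain ⟨ρ, hρ, hρa, hρb, hρc⟩ : ∃ ρ : ℝ, 0 < ρ ∧ ρ ≤ ρ1 ∧ ρ < ρ2 ∧ ρ ≤ ε :=
    ⟨min ρ1 (min (ρ2 / 2) ε), by positivity, min_le_left _ _,
      ((min_le_right _ _).trans (min_le_left _ _)).trans_lt (by linarith),
      (min_le_right _ _).trans (min_le_right _ _)⟩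
  obtain ⟨g, g', hg1, hg2, hg3, hg4, hg5, hg6⟩ := exists_smooth_norm (Y := Y) (half_pos hρ)
  have hgc : Continuous g := continuous_iff_continuousAt.2 fun u => (hg1 u).continuousAt
  set K : ℝ := 4 * (|A - m| + δ) / ρ with hK
  have hK0 : 0 < K := by rw [hK]; positivity
  have hKρ : K * (ρ / 2) = 2 * (|A - m| + δ) := by rw [hK]; field_simp; ring
  -- the inner minimisation
  have hin : ∀ x : Y, ∃ t ∈ Set.Icc (0 : ℝ) 1, ∀ t' ∈ Set.Icc (0 : ℝ) 1,
      -δ * t + K * g (x - (a + t • e)) ≤ -δ * t' + K * g (x - (a + t' • e)) := by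
    intro x
    have hc : Continuous (fun t : ℝ => -δ * t + K * g (x - (a + t • e))) := by fun_prop
    obtain ⟨t, ht, h⟩ := isCompact_Icc.exists_isMinOn (Set.nonempty_Icc.2 zero_le_one)
      (hc.continuousOn (s := Set.Icc (0 : ℝ) 1))
    exact ⟨t, ht, fun t' ht' => h ht'⟩
  choose τ hτ hτm using hin
  set H : Y → ℝ := fun x => -δ * τ x + K * g (x - (a + τ x • e)) with hH
  have hglip : ∀ x y, g x ≤ g y + ‖x - y‖ := by
    intro x y
    have h1 := hg2 x y
    have h2 := (neg_abs_le _).trans' (neg_le_neg ((g' x).le_opNorm (y - x)))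
    rw [norm_sub_rev] at h2
    nlinarith [hg3 x, norm_nonneg (x - y)]
  have hHlip : ∀ x y, H x ≤ H y + K * ‖x - y‖ := by
    intro x y
    have h1 := hτm x (τ y) (hτ y)
    have h2 := hglip (x - (a + τ y • e)) (y - (a + τ y • e))
    rw [sub_sub_sub_cancel_right] at h2
    have h3 := mul_le_mul_of_nonneg_left h2 hK0.le
    simp only [hH]
    linarith
  have hHc : Continuous H := by
    refine (LipschitzWith.of_le_add_mul (Real.toNNReal K) ?_).continuous
    intro x y
    rw [Real.coe_toNNReal _ hK0.le, dist_eq_norm]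
    exact hHlip x y
  set C : Set Y := {x | ψ x ≠ ⊤ ∧ x ∈ Metric.cthickening ρ S} with hC
  set F : Y → ℝ := fun x => (ψ x).toReal + H x with hF
  have hcl : ∀ c : ℝ, IsClosed {x | x ∈ C ∧ F x ≤ c} := by
    intro c
    have : {x | x ∈ C ∧ F x ≤ c} =
        Metric.cthickening ρ S ∩ (fun x => (x, ((c - H x : ℝ) : EReal))) ⁻¹'
          {p : Y × EReal | ψ p.1 ≤ p.2} := by
      ext x
      simp only [hC, hF, Set.mem_ofPred_eq, Set.mem_inter_iff, Set.mem_preimage]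
      constructor
      · rintro ⟨⟨h1, h2⟩, h3⟩
        refine ⟨h2, ?_⟩
        rw [← EReal.coe_toReal h1 (hnb x), EReal.coe_le_coe_iff]
        linarith
      · rintro ⟨h1, h2⟩
        have h3 : ψ x ≠ ⊤ := ne_top_of_le_ne_top (EReal.coe_ne_top _) h2
        rw [← EReal.coe_toReal h3 (hnb x), EReal.coe_le_coe_iff] at h2
        exact ⟨⟨h3, h1⟩, by linarith⟩
    rw [this]
    refine Metric.isClosed_cthickening.inter (IsClosed.preimage ?_ hlsc.isClosed_epigraph)
    exact continuous_id.prodMk (continuous_coe_real_ereal.comp (continuous_const.sub hHc))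
  have hmC : ∀ x ∈ C, m ≤ (ψ x).toReal := by
    rintro x ⟨h1, h2⟩
    have h3 : (m : EReal) < ψ x := hsub1 (Metric.cthickening_mono hρa S h2)
    rw [← EReal.coe_toReal h1 (hnb x), EReal.coe_lt_coe_iff] at h3
    exact h3.le
  have hHlow : ∀ x, -δ ≤ H x := by
    intro x
    have h1 := (hτ x).2
    have h2 := mul_nonneg hK0.le (hg5 (x - (a + τ x • e)))
    simp only [hH]
    nlinarith
  have haS : a ∈ S := ⟨0, by simp, by simp⟩
  have haC : a ∈ C := ⟨hatop, Metric.self_subset_cthickening S haS⟩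
  obtain ⟨η, hη, hη1, hη2⟩ : ∃ η : ℝ, 0 < η ∧ η * ‖e‖ ≤ δ / 2 ∧ η * ρ < (T - 1) * (δ / 2) := by
    have hT' : 0 < (T - 1) * (δ / 2) := mul_pos (by linarith) (by linarith)
    refine ⟨min (δ / 2 / (‖e‖ + 1)) ((T - 1) * (δ / 2) / (2 * ρ)), by positivity, ?_, ?_⟩
    · calc _ ≤ δ / 2 / (‖e‖ + 1) * ‖e‖ := by gcongr; exact min_le_left _ _
        _ ≤ δ / 2 / (‖e‖ + 1) * (‖e‖ + 1) := by gcongr; linarith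
        _ = δ / 2 := by field_simp
    · calc _ ≤ (T - 1) * (δ / 2) / (2 * ρ) * ρ := by gcongr; exact min_le_right _ _
        _ = (T - 1) * (δ / 2) / 2 := by field_simp
        _ < _ := by linarith
  obtain ⟨xb, hxbC, hxbF, Q, q, hQ, hq, hmin⟩ := smooth_variational C F hcl (m - δ)
    (fun x hx => by have := hmC x hx; have := hHlow x; simp only [hF]; linarith) a haC η hη
  set t := τ xb with ht
  set u := xb - (a + t • e) with hu
  have ht01 := hτ xb
  have hFa : F a ≤ A := by
    have := hτm a 0 (by simp)
    simp only [zero_smul, add_zero, sub_self, hg4, mul_zero] at this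
    simp only [hF, hH]
    linarith
  have hxbA : (ψ xb).toReal + (-δ * t + K * g u) ≤ A := hxbF.trans hFa
  have hunorm : ‖u‖ < ρ := by
    have h1 := hmC xb hxbC
    have h2 : K * g u < K * (ρ / 2) := by
      rw [hKρ]
      have := le_abs_self (A - m)
      have := abs_nonneg (A - m)
      nlinarith [ht01.2]
    have h3 := lt_of_mul_lt_mul_left h2 hK0.le
    have h4 := hg6 u
    linarith
  have ht1 : t < 1 := by
    refine lt_of_le_of_ne ht01.2 fun h1 => ?_
    have h2 : xb ∈ Metric.ball (a + e) ρ2 := by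
      rw [Metric.mem_ball, dist_eq_norm]
      rw [hu, h1, one_smul] at hunorm
      linarith
    have h3 : (r : EReal) < ψ xb := hsub2 h2
    rw [← EReal.coe_toReal hxbC.1 (hnb xb), EReal.coe_lt_coe_iff] at h3
    have h4 := mul_nonneg hK0.le (hg5 u)
    rw [h1] at hxbA
    linarith
  -- the subgradient
  have hR : HasFDerivAt (fun x => K * g (x - (a + t • e)) + Q x) (K • g' u + q) xb := by
    have h1 : HasFDerivAt (fun x => g (x - (a + t • e))) (g' u) xb :=
      (hg1 u).comp xb ((hasFDerivAt_id xb).sub_const (a + t • e))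
    exact (h1.const_mul K).add hQ
  have hsubd : -(K • g' u + q) ∈ FrechetSubdiff ψ xb := by
    refine subdiff_of_local_min ψ hnb xb hxbC.1 _ _ hR ?_
    filter_upwards [Metric.ball_mem_nhds xb (sub_pos.2 hunorm)] with y hy hytop
    have hyC : y ∈ C := by
      refine ⟨hytop, Metric.mem_cthickening_of_dist_le y (a + t • e) ρ S ⟨t, ht01, rfl⟩ ?_⟩
      rw [Metric.mem_ball] at hy
      have h1 := dist_triangle y xb (a + t • e)
      rw [dist_eq_norm xb, ← hu] at h1
      linarith
    have h1 := hmin y hyC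
    have h2 := hτm y t ht01
    simp only [hF, hH] at h1
    simp only [← ht, ← hu] at h1 ⊢
    linarith
  have hge : K * g' u e ≤ -δ := by
    have h1 : HasDerivAt (fun s : ℝ => -δ * s + K * g (xb - (a + s • e))) (-δ * 1 + K * (g' u (-((1 : ℝ) • e)))) t := by
      have h2 : HasDerivAt (fun s : ℝ => xb - (a + s • e)) (-((1 : ℝ) • e)) t :=
        (((hasDerivAt_id t).smul_const e).const_add a).const_sub xb
      have h3 : HasDerivAt (fun s : ℝ => g (xb - (a + s • e))) (g' u (-((1 : ℝ) • e))) t :=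
        HasFDerivAt.comp_hasDerivAt t (hg1 u) h2
      exact ((hasDerivAt_id t).const_mul (-δ)).add (h3.const_mul K)
    have h4 := deriv_nonneg_of_right_min _ _ t h1 ht1 (fun s hs1 hs2 =>
      hτm xb s ⟨ht01.1.trans hs1.le, hs2⟩)
    rw [one_smul, map_neg] at h4
    linarith
  have hgu : 0 ≤ g' u u := by
    have h1 := hg2 u 0
    rw [hg4, zero_sub, map_neg] at h1
    have := hg5 u
    linarith
  have hqb : ∀ v, |q v| ≤ η * ‖v‖ := fun v =>
    (q.le_opNorm v).trans (mul_le_mul_of_nonneg_right hq (norm_nonneg v))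
  refine ⟨t, ht01.1, ht1, xb, (hunorm.le.trans hρc), _, hsubd, ?_⟩
  have hdec : a + T • e - xb = (T - t) • e - u := by rw [hu]; module
  rw [hdec]
  have hval : (-(K • g' u + q)) ((T - t) • e - u) =
      (T - t) * (-(K * g' u e) - q e) + K * g' u u + q u := by
    simp only [_root_.neg_apply, _root_.add_apply, _root_.smul_apply, map_sub, map_smul, smul_eq_mul]
    ring
  rw [hval]
  have h1 := (abs_le.1 (hqb e)).2
  have h2 := (abs_le.1 (hqb u)).1
  have h3 : η * ‖u‖ ≤ η * ρ := by gcongr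
  have h4 : δ / 2 ≤ -(K * g' u e) - q e := by linarith
  have h5 : (T - 1) * (δ / 2) ≤ (T - t) * (-(K * g' u e) - q e) :=
    mul_le_mul (by linarith) h4 (by linarith) (by linarith)
  have h6 := mul_nonneg hK0.le hgu
  linarith
end meanvalue

section sepred
variable {X : Type*} [NormedAddCommGroup X] [NormedSpace ℝ X]

lemma hb_extend (Y : Submodule ℝ X) (ys : StrongDual ℝ Y) (c : ℝ) (hc : 0 ≤ c) (A0 : Set (X × ℝ))
    (h : ∀ (k : ℕ) (l : Fin k → ℝ) (a : Fin k → X × ℝ), (∀ i, 0 ≤ l i) → (∀ i, a i ∈ A0) →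
      ∀ w : Y, ys w ≤ ∑ i, l i * (a i).2 + c * ‖∑ i, l i • (a i).1 - (w : X)‖) :
    ∃ xs : X →L[ℝ] ℝ, (∀ w : Y, xs w = ys w) ∧ ∀ a ∈ A0, xs a.1 ≤ a.2 := by
  set B : Set (X × ℝ) := ⋃ w : Y, {p : X × ℝ | p.2 < ys w - c * ‖p.1 - (w : X)‖} with hB
  have hBo : IsOpen B := by
    refine isOpen_iUnion fun w => isOpen_lt continuous_snd ?_
    fun_prop
  have hBc : Convex ℝ B := by
    rintro ⟨p, s⟩ hp ⟨p', s'⟩ hp' a b ha hb hab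
    obtain ⟨w, hw⟩ := Set.mem_iUnion.1 hp
    obtain ⟨w', hw'⟩ := Set.mem_iUnion.1 hp'
    refine Set.mem_iUnion.2 ⟨a • w + b • w', ?_⟩
    change s < ys w - c * ‖p - (w : X)‖ at hw
    change s' < ys w' - c * ‖p' - (w' : X)‖ at hw'
    change a * s + b * s' < ys (a • w + b • w') - c * ‖(a • p + b • p') - ((a • w + b • w' : Y) : X)‖
    have e1 : (a • p + b • p') - ((a • w + b • w' : Y) : X) = a • (p - w) + b • (p' - w') := by
      push_cast; module
    have e2 : ‖a • (p - (w : X)) + b • (p' - (w' : X))‖ ≤ a * ‖p - w‖ + b * ‖p' - w'‖ := by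
      refine (norm_add_le _ _).trans ?_
      rw [norm_smul, norm_smul, Real.norm_of_nonneg ha, Real.norm_of_nonneg hb]
    have e3 := mul_le_mul_of_nonneg_left e2 hc
    rw [e1, map_add, map_smul, map_smul, smul_eq_mul, smul_eq_mul]
    have e4 : a * s + b * s' < a * (ys w - c * ‖p - (w : X)‖) + b * (ys w' - c * ‖p' - (w' : X)‖) := by
      rcases eq_or_lt_of_le ha with h0 | h0
      · have hb1 : b = 1 := by linarith
        rw [← h0, hb1]; linarith
      · have h1 := mul_lt_mul_of_pos_left hw h0
        have h2 := mul_le_mul_of_nonneg_left hw'.le hb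
        linarith
    linarith
  set A : Set (X × ℝ) := (Submodule.span NNReal A0 : Set (X × ℝ)) with hA
  have hAc : Convex ℝ A := by
    intro p hp p' hp' a b ha hb hab
    have h1 := (Submodule.span NNReal A0).smul_mem (⟨a, ha⟩ : NNReal) hp
    have h2 := (Submodule.span NNReal A0).smul_mem (⟨b, hb⟩ : NNReal) hp'
    exact (Submodule.span NNReal A0).add_mem h1 h2
  have hdis : Disjoint B A := by
    rw [Set.disjoint_left]
    intro p hp hpA
    obtain ⟨w, hw⟩ := Set.mem_iUnion.1 hp
    obtain ⟨k, l, a, hsum⟩ := Submodule.mem_span_set'.1 hpA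
    have h1 := h k (fun i => (l i : ℝ)) (fun i => (a i : X × ℝ)) (fun i => (l i).2) (fun i => (a i).2) w
    have e1 : p.1 = ∑ i, (l i : ℝ) • (a i : X × ℝ).1 := by
      rw [← hsum, Prod.fst_sum]; rfl
    have e2 : p.2 = ∑ i, (l i : ℝ) * (a i : X × ℝ).2 := by
      rw [← hsum, Prod.snd_sum]; rfl
    rw [← e1, ← e2] at h1
    change p.2 < ys w - c * ‖p.1 - (w : X)‖ at hw
    linarith
  obtain ⟨F, u, hFB, hFA⟩ := geometric_hahn_banach_open hBc hBo hAc hdis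
  have hF : ∀ (x : X) (s : ℝ), F (x, s) = F (x, 0) + s * F (0, 1) := by
    intro x s
    have : ((x, s) : X × ℝ) = (x, 0) + s • (0, 1) := by ext <;> simp
    rw [this, map_add, map_smul, smul_eq_mul]
  set κ := F (0, 1) with hκ
  have hu0 : u ≤ 0 := by
    have := hFA 0 (Submodule.span NNReal A0).zero_mem
    simpa using this
  have hBmem : ∀ (w : Y) (s : ℝ), 0 < s → ((w : X), ys w - s) ∈ B := by
    intro w s hs
    refine Set.mem_iUnion.2 ⟨w, ?_⟩
    change ys w - s < ys w - c * ‖(w : X) - (w : X)‖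
    rw [sub_self, norm_zero]; linarith
  have hκ0 : 0 < κ := by
    have := hFB _ (hBmem 0 1 one_pos)
    rw [hF] at this
    have e : F (((0 : Y) : X), 0) = 0 := by
      rw [ZeroMemClass.coe_zero]; exact map_zero F
    rw [e, map_zero] at this
    linarith
  have hFw : ∀ w : Y, F ((w : X), 0) + ys w * κ ≤ 0 := by
    intro w
    refine le_of_forall_pos_le_add fun s hs => ?_
    have := hFB _ (hBmem w (s / κ) (by positivity))
    rw [hF] at this
    have e : s / κ * κ = s := by field_simp
    nlinarith
  have hneg : ∀ x : X, F (-x, 0) = - F (x, 0) := by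
    intro x
    rw [← map_neg]; simp
  have hFA0 : ∀ a ∈ A, 0 ≤ F a := by
    intro a ha
    by_contra hlt
    push Not at hlt
    have hpos : 0 ≤ (u - 1) / F a := div_nonneg_of_nonpos (by linarith) hlt.le
    have this : u ≤ F (((u - 1) / F a) • a) :=
      hFA _ ((Submodule.span NNReal A0).smul_mem (⟨(u - 1) / F a, hpos⟩ : NNReal) ha)
    rw [map_smul, smul_eq_mul, div_mul_cancel₀ _ hlt.ne] at this
    linarith
  refine ⟨-(κ⁻¹ • (F.comp (ContinuousLinearMap.inl ℝ X ℝ))), ?_, ?_⟩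
  · intro w
    have h1 := hFw w
    have h2 := hFw (-w)
    rw [map_neg, NegMemClass.coe_neg, hneg] at h2
    have h3 : F ((w : X), 0) = - (ys w * κ) := by linarith
    simp only [_root_.neg_apply, _root_.smul_apply, ContinuousLinearMap.comp_apply,
      ContinuousLinearMap.inl_apply, smul_eq_mul]
    rw [h3]
    field_simp
  · rintro ⟨x, s⟩ ha
    have h1 := hFA0 _ (Submodule.subset_span ha)
    rw [hF] at h1
    simp only [_root_.neg_apply, _root_.smul_apply, ContinuousLinearMap.comp_apply,
      ContinuousLinearMap.inl_apply, smul_eq_mul]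
    have : κ⁻¹ * (F (x, 0) + s * κ) = κ⁻¹ * F (x, 0) + s := by field_simp
    have h2 : 0 ≤ κ⁻¹ * (F (x, 0) + s * κ) := by positivity
    linarith

/-- Finite families witnessing non-extendability. -/
def Viol (f : X → EReal) (k : ℕ) (l r d : Fin k → ℝ) (c q : ℝ) (x w : X) (z : Fin k → X) : Prop :=
  (∀ i, ‖z i - x‖ < d i) ∧
    ∑ i, l i * ((f (z i)).toReal + r i * ‖z i - x‖) + c * ‖∑ i, l i • (z i - x) - w‖ < q

lemma closing_off (f : X → EReal) (V : Submodule ℝ X)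
    (hV : TopologicalSpace.IsSeparable (V : Set X)) (k : ℕ) :
    ∃ T : Set (Fin k → X), T.Countable ∧ ∀ (l r d : Fin k → ℝ) (c q : ℝ) (x w : X),
      x ∈ V → w ∈ V → (∃ z, (∀ i, f (z i) ≠ ⊤) ∧ Viol f k l r d c q x w z) →
      ∃ z ∈ T, (∀ i, f (z i) ≠ ⊤) ∧ Viol f k l r d c q x w z := by
  have : TopologicalSpace.SeparableSpace V := hV.separableSpace
  have : SecondCountableTopology V := UniformSpace.secondCountable_of_separable V
  let I := {z : Fin k → X // ∀ i, f (z i) ≠ ⊤}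
  let s : I → Set ((Fin k → ℝ) × (Fin k → ℝ) × (Fin k → ℝ) × ℝ × ℝ × V × V) := fun z => {p : (Fin k → ℝ) × (Fin k → ℝ) × (Fin k → ℝ) × ℝ × ℝ × V × V | Viol f k p.1 p.2.1 p.2.2.1 p.2.2.2.1 p.2.2.2.2.1
    (p.2.2.2.2.2.1 : X) (p.2.2.2.2.2.2 : X) z.1}
  obtain ⟨T, hT, hTU⟩ := TopologicalSpace.isOpen_iUnion_countable s (by
    intro z
    have : s z = (⋂ i, {p : (Fin k → ℝ) × (Fin k → ℝ) × (Fin k → ℝ) × ℝ × ℝ × V × V | ‖z.1 i - (p.2.2.2.2.2.1 : X)‖ < p.2.2.1 i}) ∩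
      {p : (Fin k → ℝ) × (Fin k → ℝ) × (Fin k → ℝ) × ℝ × ℝ × V × V | ∑ i, p.1 i * ((f (z.1 i)).toReal + p.2.1 i * ‖z.1 i - (p.2.2.2.2.2.1 : X)‖)
        + p.2.2.2.1 * ‖∑ i, p.1 i • (z.1 i - (p.2.2.2.2.2.1 : X)) - (p.2.2.2.2.2.2 : X)‖
          < p.2.2.2.2.1} := by
      ext p
      simp only [s, Viol, Set.mem_ofPred_eq, Set.mem_inter_iff, Set.mem_iInter]
    rw [this]
    refine IsOpen.inter (isOpen_iInter_of_finite fun i => isOpen_lt ?_ ?_) (isOpen_lt ?_ ?_) <;>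
    fun_prop)
  refine ⟨Subtype.val '' T, hT.image _, ?_⟩
  rintro l r d c q x w hx hw ⟨z, hz, hzv⟩
  have hmem : ((l, r, d, c, q, ⟨x, hx⟩, ⟨w, hw⟩) : (Fin k → ℝ) × (Fin k → ℝ) × (Fin k → ℝ) × ℝ × ℝ × V × V) ∈ ⋃ i, s i :=
    Set.mem_iUnion.2 ⟨⟨z, hz⟩, hzv⟩
  rw [← hTU] at hmem
  obtain ⟨z', hz'⟩ := Set.mem_iUnion.1 hmem
  obtain ⟨hz'T, hz'v⟩ := Set.mem_iUnion.1 hz'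
  exact ⟨z'.1, ⟨z', hz'T, rfl⟩, z'.2, hz'v⟩

lemma exists_closed_off (f : X → EReal) (S0 : Set X) (hS0 : S0.Countable) :
    ∃ V : ℕ → Submodule ℝ X, Monotone V ∧ (∀ n, TopologicalSpace.IsSeparable (V n : Set X)) ∧
      S0 ⊆ V 0 ∧ ∀ n (k : ℕ) (l r d : Fin k → ℝ) (c q : ℝ) (x w : X),
      x ∈ V n → w ∈ V n → (∃ z, (∀ i, f (z i) ≠ ⊤) ∧ Viol f k l r d c q x w z) →
      ∃ z : Fin k → X, (∀ i, z i ∈ V (n + 1)) ∧ (∀ i, f (z i) ≠ ⊤) ∧ Viol f k l r d c q x w z := by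
  have hstep : ∀ D : {S : Set X // S.Countable}, ∃ D' : {S : Set X // S.Countable},
      D.1 ⊆ D'.1 ∧ ∀ (k : ℕ) (l r d : Fin k → ℝ) (c q : ℝ) (x w : X),
      x ∈ Submodule.span ℝ D.1 → w ∈ Submodule.span ℝ D.1 →
      (∃ z, (∀ i, f (z i) ≠ ⊤) ∧ Viol f k l r d c q x w z) →
      ∃ z : Fin k → X, (∀ i, z i ∈ D'.1) ∧ (∀ i, f (z i) ≠ ⊤) ∧ Viol f k l r d c q x w z := by
    rintro ⟨D, hD⟩
    choose T hT1 hT2 using closing_off f (Submodule.span ℝ D) hD.isSeparable.span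
    refine ⟨⟨D ∪ ⋃ k, ⋃ z ∈ T k, Set.range z, hD.union (Set.countable_iUnion fun k =>
      (hT1 k).biUnion fun z _ => Set.countable_range z)⟩, Set.subset_union_left, ?_⟩
    intro k l r d c q x w hx hw hz
    obtain ⟨z, hzT, hz1, hz2⟩ := hT2 k l r d c q x w hx hw hz
    refine ⟨z, fun i => Or.inr ?_, hz1, hz2⟩
    exact Set.mem_iUnion.2 ⟨k, Set.mem_iUnion₂.2 ⟨z, hzT, i, rfl⟩⟩
  choose step hst1 hst2 using hstep
  let D : ℕ → {S : Set X // S.Countable} := fun n => Nat.rec ⟨S0, hS0⟩ (fun _ => step) n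
  have hDS : ∀ n, D (n + 1) = step (D n) := fun n => rfl
  refine ⟨fun n => Submodule.span ℝ (D n).1, ?_, fun n => (D n).2.isSeparable.span,
    Submodule.subset_span, ?_⟩
  · refine monotone_nat_of_le_succ fun n => Submodule.span_mono ?_
    rw [hDS]; exact hst1 _
  · intro n k l r d c q x w hx hw hz
    obtain ⟨z, h1, h2⟩ := hst2 (D n) k l r d c q x w hx hw hz
    exact ⟨z, fun i => Submodule.subset_span (by rw [hDS]; exact h1 i), h2⟩

lemma sep_reduction (f : X → EReal) (hnb : ∀ x, f x ≠ ⊥) (S0 : Set X) (hS0 : S0.Countable) :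
    ∃ Y : Submodule ℝ X, IsClosed (Y : Set X) ∧ TopologicalSpace.SeparableSpace Y ∧ S0 ⊆ Y ∧
      ∀ x : Y, ∀ ys ∈ FrechetSubdiff (fun y : Y => f y) x,
        ∃ xs ∈ FrechetSubdiff f x, ∀ y : Y, xs y = ys y := by
  obtain ⟨V, hVm, hVs, hV0, hV⟩ := exists_closed_off f S0 hS0
  set W : Submodule ℝ X := ⨆ n, V n with hW
  have hWmem : ∀ x, x ∈ W ↔ ∃ n, x ∈ V n := fun x =>
    Submodule.mem_iSup_of_directed V (hVm.directed_le)
  have hWs : TopologicalSpace.IsSeparable (W : Set X) := by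
    have : (W : Set X) = ⋃ n, (V n : Set X) := by
      ext x; simp [hWmem]
    rw [this]
    exact TopologicalSpace.IsSeparable.iUnion hVs
  have hVW : ∀ n, V n ≤ W := fun n => le_iSup V n
  have hWY : W ≤ W.topologicalClosure := W.le_topologicalClosure
  have hdense : ∀ x ∈ W.topologicalClosure, ∀ η > 0, ∃ x' ∈ W, ‖x - x'‖ < η := by
    intro x hx η hη
    obtain ⟨x', h1, h2⟩ := Metric.mem_closure_iff.1 hx η hη
    exact ⟨x', h1, by rwa [← dist_eq_norm]⟩
  refine ⟨W.topologicalClosure, W.isClosed_topologicalClosure, ?_, ?_, ?_⟩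
  · have : TopologicalSpace.IsSeparable (W.topologicalClosure : Set X) := hWs.closure
    exact this.separableSpace
  · exact fun x hx => hWY (hVW 0 (hV0 hx))
  rintro x ys ⟨hxtop, hys⟩
  have hδ : ∀ ε : ℝ, ∃ δ : ℝ, 0 < δ ∧ (0 < ε → ∀ y : W.topologicalClosure, ‖(y : X) - x‖ < δ →
      f y ≠ ⊤ → ys (y - x) ≤ (f y).toReal - (f x).toReal + ε * ‖(y : X) - x‖) := by
    intro ε
    by_cases hε : 0 < ε
    · obtain ⟨δ, hδ, hball⟩ := Metric.eventually_nhds_iff.1 (hys ε hε)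
      refine ⟨δ, hδ, fun _ y hy hytop => ?_⟩
      have hxtop1 : f x ≠ ⊤ := hxtop
      have h1 : f x + ((ys (y - x) : ℝ) : EReal) - ((ε * ‖y - x‖ : ℝ) : EReal) ≤ f y :=
        hball (y := y) (by rw [dist_eq_norm]; exact hy)
      rw [← EReal.coe_toReal hytop (hnb y), ← EReal.coe_toReal hxtop1 (hnb x),
        ← EReal.coe_add, ← EReal.coe_sub, EReal.coe_le_coe_iff] at h1
      have e : ‖y - x‖ = ‖(y : X) - x‖ := rfl
      rw [e] at h1
      linarith
    · exact ⟨1, one_pos, fun h => absurd h hε⟩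
  choose δ hδ0 hδ1 using hδ
  set c := ‖ys‖ with hc
  set A0 : Set (X × ℝ) := {p | ∃ (z : X) (ε : ℝ), 0 < ε ∧ ‖z - x‖ < δ ε / 2 ∧ f z ≠ ⊤ ∧
    p = (z - x, (f z).toReal - (f x).toReal + ε * ‖z - x‖)} with hA0
  obtain ⟨xs, hxs1, hxs2⟩ := hb_extend W.topologicalClosure ys c (norm_nonneg _) A0 (by
    intro k l a hl ha w
    choose z ε hε hzδ hztop hza using ha
    by_contra hlt
    push Not at hlt
    simp only [hza] at hlt
    set val := ∑ i, l i * ((f (z i)).toReal + ε i * ‖z i - x‖) +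
      c * ‖∑ i, l i • (z i - x) - (w : X)‖ with hval
    set q := ys w + (∑ i, l i) * (f x).toReal with hq
    have hvq : val < q := by
      have : ∑ i, l i * ((f (z i)).toReal - (f x).toReal + ε i * ‖z i - (x : X)‖) =
          ∑ i, l i * ((f (z i)).toReal + ε i * ‖z i - x‖) - (∑ i, l i) * (f x).toReal := by
        rw [Finset.sum_mul, ← Finset.sum_sub_distrib]
        exact Finset.sum_congr rfl fun i _ => by ring
      rw [this] at hlt
      linarith
    -- a Lipschitz constant for the dependence on `x`, `w`
    set M := ∑ i, l i * ε i + c * (∑ i, l i + 1) with hM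
    have hM0 : 0 ≤ M := by
      have h1 : 0 ≤ ∑ i, l i * ε i := Finset.sum_nonneg fun i _ => mul_nonneg (hl i) (hε i).le
      have h2 : 0 ≤ ∑ i, l i := Finset.sum_nonneg fun i _ => hl i
      have h3 : 0 ≤ c := norm_nonneg _
      positivity
    have hlip : ∀ (x1 x2 w1 w2 : X) (z : Fin k → X) (η : ℝ), ‖x1 - x2‖ ≤ η → ‖w1 - w2‖ ≤ η →
        ∑ i, l i * ((f (z i)).toReal + ε i * ‖z i - x1‖) + c * ‖∑ i, l i • (z i - x1) - w1‖ ≤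
        ∑ i, l i * ((f (z i)).toReal + ε i * ‖z i - x2‖) + c * ‖∑ i, l i • (z i - x2) - w2‖
          + M * η := by
      intro x1 x2 w1 w2 z η h1 h2
      have e1 : ∑ i, l i * ((f (z i)).toReal + ε i * ‖z i - x1‖) ≤
          ∑ i, l i * ((f (z i)).toReal + ε i * ‖z i - x2‖) + (∑ i, l i * ε i) * η := by
        rw [Finset.sum_mul, ← Finset.sum_add_distrib]
        refine Finset.sum_le_sum fun i _ => ?_
        have h3 : ‖z i - x1‖ ≤ ‖z i - x2‖ + η := by
          have h4 := norm_sub_le (z i - x2) (x1 - x2)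
          rw [sub_sub_sub_cancel_right] at h4
          linarith
        have h5 := mul_le_mul_of_nonneg_left h3 (mul_nonneg (hl i) (hε i).le)
        nlinarith
      have e2 : ‖∑ i, l i • (z i - x1) - w1‖ ≤ ‖∑ i, l i • (z i - x2) - w2‖ + (∑ i, l i + 1) * η := by
        have h0 : 0 ≤ ∑ i, l i := Finset.sum_nonneg fun i _ => hl i
        have h3 : ∑ i, l i • (z i - x1) - w1 =
            (∑ i, l i • (z i - x2) - w2) - ((∑ i, l i) • (x1 - x2) + (w1 - w2)) := by
          have : ∑ i, l i • (z i - x1) = ∑ i, l i • (z i - x2) - (∑ i, l i) • (x1 - x2) := by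
            rw [Finset.sum_smul, ← Finset.sum_sub_distrib]
            exact Finset.sum_congr rfl fun i _ => by module
          rw [this]; abel
        rw [h3]
        refine (norm_sub_le _ _).trans ?_
        have h4 := norm_add_le ((∑ i, l i) • (x1 - x2)) (w1 - w2)
        rw [norm_smul, Real.norm_of_nonneg h0] at h4
        have h5 := mul_le_mul_of_nonneg_left h1 h0
        linarith
      have e3 := mul_le_mul_of_nonneg_left e2 (norm_nonneg ys)
      rw [← hc] at e3
      rw [hM]
      linarith
    -- choose the perturbation size
    obtain ⟨η, hη0, hηM, hηδ, hηz⟩ : ∃ η : ℝ, 0 < η ∧ 2 * (M * η) < q - val ∧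
        (∀ i, η < δ (ε i) / 2) ∧ ∀ i, ‖z i - x‖ + η < δ (ε i) / 2 := by
      have ev : ∀ᶠ η in 𝓝[>] (0 : ℝ), 0 < η ∧ 2 * (M * η) < q - val ∧
        (∀ i, η < δ (ε i) / 2) ∧ ∀ i, ‖z i - x‖ + η < δ (ε i) / 2 := by
        refine eventually_mem_nhdsWithin.and ((Filter.Eventually.and ?_ (Filter.Eventually.and
          (eventually_all.2 fun i => ?_) (eventually_all.2 fun i => ?_))).filter_mono
            nhdsWithin_le_nhds)
        · have : Tendsto (fun η : ℝ => 2 * (M * η)) (𝓝 0) (𝓝 (2 * (M * 0))) :=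
            (by fun_prop : Continuous (fun η : ℝ => 2 * (M * η))).tendsto 0
          exact this.eventually (gt_mem_nhds (by linarith))
        · exact gt_mem_nhds (half_pos (hδ0 _))
        · have : Tendsto (fun η : ℝ => ‖z i - x‖ + η) (𝓝 0) (𝓝 (‖z i - x‖ + 0)) :=
            (by fun_prop : Continuous (fun η : ℝ => ‖z i - x‖ + η)).tendsto 0
          exact this.eventually (gt_mem_nhds (by linarith [hzδ i]))
      exact ev.exists
    obtain ⟨x', hx'W, hx'⟩ := hdense x x.2 η hη0
    obtain ⟨w', hw'W, hw'⟩ := hdense w w.2 η hη0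
    obtain ⟨n1, hn1⟩ := (hWmem x').1 hx'W
    obtain ⟨n2, hn2⟩ := (hWmem w').1 hw'W
    obtain ⟨z', hz'V, hz'top, hz'1, hz'2⟩ := hV (max n1 n2) k l ε (fun i => δ (ε i) / 2) c
      (val + M * η + (q - val - 2 * (M * η))) x' w'
      (hVm (le_max_left _ _) hn1) (hVm (le_max_right _ _) hn2)
      ⟨z, hztop, fun i => by
        have h4 := norm_sub_le (z i - x) (x' - x)
        rw [sub_sub_sub_cancel_right, norm_sub_rev x'] at h4
        linarith [hηz i], by
        have := hlip x' x w' w z η (by rw [norm_sub_rev]; exact hx'.le)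
          (by rw [norm_sub_rev]; exact hw'.le)
        rw [← hval] at this
        linarith⟩
    have h5 := hlip x x' w w' z' η hx'.le hw'.le
    have h6 : ∑ i, l i * ((f (z' i)).toReal + ε i * ‖z' i - x‖) +
        c * ‖∑ i, l i • (z' i - x) - (w : X)‖ < q := by linarith
    have hz'Y : ∀ i, z' i ∈ W.topologicalClosure := fun i => hWY (hVW _ (hz'V i))
    set y : Fin k → W.topologicalClosure := fun i => ⟨z' i, hz'Y i⟩ with hy
    have h7 : ∀ i, ys (y i - x) ≤ (f (z' i)).toReal - (f x).toReal + ε i * ‖z' i - x‖ := by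
      intro i
      refine hδ1 (ε i) (hε i) (y i) ?_ (hz'top i)
      have h8 := hz'1 i
      simp only at h8
      have h9 := norm_add_le (z' i - x') (x' - x)
      rw [sub_add_sub_cancel, norm_sub_rev x'] at h9
      change ‖z' i - x‖ < _
      linarith [hηδ i]
    have h10 : ys (∑ i, l i • (y i - x)) ≤
        ∑ i, l i * ((f (z' i)).toReal + ε i * ‖z' i - x‖) - (∑ i, l i) * (f x).toReal := by
      rw [map_sum, Finset.sum_mul, ← Finset.sum_sub_distrib]
      refine Finset.sum_le_sum fun i _ => ?_
      rw [map_smul, smul_eq_mul]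
      have := mul_le_mul_of_nonneg_left (h7 i) (hl i)
      linarith
    have h11 := (neg_abs_le _).trans' (neg_le_neg (ys.le_opNorm (∑ i, l i • (y i - x) - w)))
    have h12 : ‖∑ i, l i • (y i - x) - w‖ = ‖∑ i, l i • (z' i - x) - (w : X)‖ := by
      have e : ((∑ i, l i • (y i - x) - w : W.topologicalClosure) : X) =
          ∑ i, l i • (z' i - x) - (w : X) := by
        push_cast
        rfl
      rw [← e]
      rfl
    rw [h12, map_sub, ← hc] at h11
    linarith)
  refine ⟨xs, ⟨hxtop, fun ε hε => ?_⟩, hxs1⟩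
  filter_upwards [Metric.ball_mem_nhds (x : X) (half_pos (hδ0 ε))] with z hz
  by_cases hztop : f z = ⊤
  · rw [hztop]; exact le_top
  rw [Metric.mem_ball, dist_eq_norm] at hz
  have h1 := hxs2 _ ⟨z, ε, hε, hz, hztop, rfl⟩
  simp only at h1
  have h2 : f x ≠ ⊤ := hxtop
  rw [← EReal.coe_toReal hztop (hnb z), ← EReal.coe_toReal h2 (hnb x),
    ← EReal.coe_add, ← EReal.coe_sub, EReal.coe_le_coe_iff]
  linarith
end sepred

section final
variable {X : Type*} [NormedAddCommGroup X] [NormedSpace ℝ X]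

lemma mvt_asplund [CompleteSpace X] (hX : IsAsplund X) (ψ : X → EReal) (hlsc : LowerSemicontinuous ψ)
    (hnb : ∀ x, ψ x ≠ ⊥) (a e : X) (T : ℝ) (hT : 1 < T) (hab : ψ a < ψ (a + e))
    (ε : ℝ) (hε : 0 < ε) :
    ∃ t : ℝ, 0 ≤ t ∧ t < 1 ∧ ∃ c, ‖c - (a + t • e)‖ ≤ ε ∧
      ∃ cs ∈ FrechetSubdiff ψ c, 0 < cs (a + T • e - c) := by
  obtain ⟨Y, hYc, hYs, hSY, hext⟩ := sep_reduction ψ hnb {a, e} (Set.toFinite _).countable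
  have ha : a ∈ Y := hSY (by simp)
  have he : e ∈ Y := hSY (by simp)
  have hYd : TopologicalSpace.SeparableSpace (StrongDual ℝ Y) := hX Y hYc hYs
  have hYcomp : CompleteSpace Y := hYc.completeSpace_coe
  obtain ⟨t, ht0, ht1, c, hc, cs, hcs, hpos⟩ := mvt_sep (fun y : Y => ψ y)
    (fun x c hc => (continuous_subtype_val.tendsto x).eventually (hlsc x c hc)) (fun y => hnb y) ⟨a, ha⟩ ⟨e, he⟩ T hT hab ε hε
  obtain ⟨xs, hxs, hxe⟩ := hext c cs hcs
  refine ⟨t, ht0, ht1, c, hc, xs, hxs, ?_⟩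
  rw [← hxe] at hpos
  exact hpos

lemma frechet_sub_linear (φ : X → EReal) (hnb : ∀ x, φ x ≠ ⊥) (vs : X →L[ℝ] ℝ) (c : X)
    (cs : X →L[ℝ] ℝ) (h : cs ∈ FrechetSubdiff (fun z => φ z + ((vs z : ℝ) : EReal)) c) :
    cs - vs ∈ FrechetSubdiff φ c := by
  obtain ⟨h1, h2⟩ := h
  have hc : φ c ≠ ⊤ := by
    intro h
    apply h1
    simp [h]
  refine ⟨hc, fun ε hε => ?_⟩
  filter_upwards [h2 ε hε] with y hy
  by_cases hy1 : φ y = ⊤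
  · rw [hy1]; exact le_top
  rw [← EReal.coe_toReal hy1 (hnb y), ← EReal.coe_toReal hc (hnb c)] at hy ⊢
  rw [← EReal.coe_add, ← EReal.coe_add, ← EReal.coe_add, ← EReal.coe_sub,
    EReal.coe_le_coe_iff] at hy
  rw [← EReal.coe_add, ← EReal.coe_sub, EReal.coe_le_coe_iff, _root_.sub_apply]
  have := map_sub vs y c
  linarith

lemma lsc_add_linear (φ : X → EReal) (hlsc : LowerSemicontinuous φ)
    (vs : X →L[ℝ] ℝ) : LowerSemicontinuous (fun z => φ z + ((vs z : ℝ) : EReal)) := by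
  refine LowerSemicontinuous.add' hlsc
    (Continuous.lowerSemicontinuous (continuous_coe_real_ereal.comp vs.continuous)) fun x => ?_
  exact EReal.continuousAt_add (Or.inr (EReal.coe_ne_bot _)) (Or.inr (EReal.coe_ne_top _))

end final

/-- Theorem 3.5, sufficiency: in an Asplund space, if for all `x* ∈ ∂̂φ(x)`,
`y* ∈ ∂̂φ(y)` the implication `min{⟨x*, y - x⟩, ⟨y*, x - y⟩} > -α‖y - x‖ →
⟨x* - y*, x - y⟩ ≥ 0` holds, then `φ` is `α`-robustly quasiconvex. -/
theorem pseudomonotone_cond_imp_robustly_quasiconvex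
    {X : Type*} [NormedAddCommGroup X] [NormedSpace ℝ X] [CompleteSpace X]
    (hX : IsAsplund X) (φ : X → EReal)
    (hproper : ∃ x, φ x ≠ ⊤) (hnobot : ∀ x, φ x ≠ ⊥)
    (hlsc : LowerSemicontinuous φ)
    (α : ℝ) (hα : 0 < α)
    (hcond : ∀ x y : X, ∀ xs ∈ FrechetSubdiff φ x, ∀ ys ∈ FrechetSubdiff φ y,
      -(α * ‖y - x‖) < min (xs (y - x)) (ys (x - y)) →
      0 ≤ (xs - ys) (x - y)) :
    RobustlyQuasiconvex φ α := by
  intro vs hvs x y l hl0 hl1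
  by_contra hlt
  push Not at hlt
  set ψ : X → EReal := fun z => φ z + ((vs z : ℝ) : EReal) with hψ
  have hψlsc : LowerSemicontinuous ψ := lsc_add_linear φ hlsc vs
  have hψnb : ∀ x, ψ x ≠ ⊥ := by
    intro x
    simp only [hψ, ne_eq, EReal.add_eq_bot_iff, hnobot x, EReal.coe_ne_bot, or_self,
      not_false_eq_true]
  obtain ⟨hltx, hlty⟩ := max_lt_iff.1 hlt
  change ψ x < ψ _ at hltx
  change ψ y < ψ _ at hlty
  set z := l • x + (1 - l) • y with hz
  have hm0 : 0 < 1 - l := by linarith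
  obtain ⟨r, hr0, hr⟩ := Metric.eventually_nhds_iff.1 (hψlsc z _ hlty)
  have hex : x + (1 - l) • (y - x) = z := by rw [hz]; module
  obtain ⟨t, ht0, ht1, u, hu, us, hus, hupos⟩ := mvt_asplund hX ψ hψlsc hψnb x
    ((1 - l) • (y - x)) (1 - l)⁻¹ (by rw [one_lt_inv₀ hm0]; linarith)
    (by rw [hex]; exact hltx) (r / 2) (half_pos hr0)
  have e1 : x + (1 - l)⁻¹ • (1 - l) • (y - x) - u = y - u := by
    rw [smul_smul, inv_mul_cancel₀ hm0.ne', one_smul]; abel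
  rw [e1] at hupos
  have htm : t * (1 - l) < 1 := by nlinarith
  have hden : 0 < 1 - t * (1 - l) := by linarith
  obtain ⟨s, hs⟩ : ∃ s, s = (1 - l) * (1 - t) / (1 - t * (1 - l)) := ⟨_, rfl⟩
  have hsd : s * (1 - t * (1 - l)) = (1 - l) * (1 - t) := by
    rw [hs, div_mul_cancel₀ _ hden.ne']
  have hs0 : 0 < s := by
    rw [hs]; exact div_pos (mul_pos hm0 (by linarith)) hden
  have hs1 : s < 1 := by
    rw [hs, div_lt_one hden]; nlinarith
  have hz' : ψ y < ψ (u + s • (y - u)) := by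
    apply hr
    rw [dist_eq_norm]
    have e2 : u + s • (y - u) - z = (1 - s) • (u - (x + t • (1 - l) • (y - x))) := by
      have e3 : z = (x + t • (1 - l) • (y - x)) + s • (y - (x + t • (1 - l) • (y - x))) := by
        have e4 : (x + t • (1 - l) • (y - x)) + s • (y - (x + t • (1 - l) • (y - x)))
            = x + (t * (1 - l) + s * (1 - t * (1 - l))) • (y - x) := by module
        rw [e4, hsd, ← hex]
        congr 2
        ring
      rw [e3]; module
    rw [e2, norm_smul, Real.norm_of_nonneg (by linarith)]
    have := norm_nonneg (u - (x + t • (1 - l) • (y - x)))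
    nlinarith
  obtain ⟨ε, hε0, hε⟩ : ∃ ε : ℝ, 0 < ε ∧ ‖us‖ * ε < s * us (y - u) := by
    have hp : 0 < s * us (y - u) := mul_pos hs0 hupos
    refine ⟨s * us (y - u) / (‖us‖ + 1), by positivity, ?_⟩
    have hn := norm_nonneg us
    rw [← mul_div_assoc, div_lt_iff₀ (by positivity)]
    nlinarith
  have hq0 : 0 < 1 - s := by linarith
  obtain ⟨t2, ht20, ht21, w, hw, ws, hws, hwpos⟩ := mvt_asplund hX ψ hψlsc hψnb y
    ((1 - s) • (u - y)) (1 - s)⁻¹ (by rw [one_lt_inv₀ hq0]; linarith)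
    (by
      have : y + (1 - s) • (u - y) = u + s • (y - u) := by module
      rw [this]; exact hz') ε hε0
  have e5 : y + (1 - s)⁻¹ • (1 - s) • (u - y) - w = u - w := by
    rw [smul_smul, inv_mul_cancel₀ hq0.ne', one_smul]; abel
  rw [e5] at hwpos
  have hwu : 0 < us (w - u) := by
    have e6 : w - u = (w - (y + t2 • (1 - s) • (u - y))) + (1 - t2 * (1 - s)) • (y - u) := by
      module
    have h7 : -(‖us‖ * ε) ≤ us (w - (y + t2 • (1 - s) • (u - y))) := by
      have h8 := us.le_opNorm (w - (y + t2 • (1 - s) • (u - y)))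
      have h9 := mul_le_mul_of_nonneg_left hw (norm_nonneg us)
      rw [Real.norm_eq_abs] at h8
      linarith [neg_abs_le (us (w - (y + t2 • (1 - s) • (u - y))))]
    have h10 : s * us (y - u) ≤ (1 - t2 * (1 - s)) * us (y - u) := by
      apply mul_le_mul_of_nonneg_right _ hupos.le
      nlinarith
    rw [e6, map_add, map_smul, smul_eq_mul]
    linarith
  have hv : |vs (w - u)| ≤ α * ‖w - u‖ := by
    rw [← Real.norm_eq_abs]
    exact (vs.le_opNorm _).trans (mul_le_mul_of_nonneg_right hvs (norm_nonneg _))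
  have hv2 : vs (u - w) = - vs (w - u) := by rw [← map_neg, neg_sub]
  have hws2 : ws (u - w) = - ws (w - u) := by rw [← map_neg, neg_sub]
  have hus2 : us (u - w) = - us (w - u) := by rw [← map_neg, neg_sub]
  have := hcond u w _ (frechet_sub_linear φ hnobot vs u us hus) _
    (frechet_sub_linear φ hnobot vs w ws hws) (by
      rw [lt_min_iff, _root_.sub_apply, _root_.sub_apply]
      constructor
      · linarith [le_abs_self (vs (w - u))]
      · linarith [neg_abs_le (vs (w - u))])
  rw [_root_.sub_apply, _root_.sub_apply, _root_.sub_apply] at this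
  linarith
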